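/- Suppose char(F) = 2 and q is non-degenerate with Witt index n ≥ 2 (arbitrary anisotropic defect d₀ = N − 2n and arbitrary d'₀ = dim Rad(f_q)), i.e., V is an f_q-orthogonal direct sum V = V₁ ⊕ ⋯ ⊕ Vₙ ⊕ V₀ with each Vᵢ a hyperbolic plane for q and V₀ anisotropic. Then for every integer k with 1 ≤ k ≤ n, the Grassmann image G_k(q) coincides with the symplectic Grassmann image S_k(f_q); in particular dim G_k(q) = binom(N, k) − binom(N, k−2), with binom(N, −1) := 0. -/

import Mathlib

noncomputable section

namespace PolarGrass

open Module

variable (F : Type*) [Field F] (V : Type*) [AddCommGroup V] [Module F V]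

/-- A subspace `W` is totally singular for the pairing `B` if `B` vanishes identically on it. -/
def TotSingB (B : V → V → F) (W : Submodule F V) : Prop :=
  ∀ x ∈ W, ∀ y ∈ W, B x y = 0

/-- A subspace `W` is totally singular for the quadratic form `q` if `q` vanishes on it. -/
def TotSingQ (q : QuadraticForm F V) (W : Submodule F V) : Prop :=
  ∀ x ∈ W, q x = 0

/-- The polarization of a quadratic form, as a bare pairing. -/
def polarF (q : QuadraticForm F V) : V → V → F :=
  fun x y => QuadraticMap.polar (⇑q) x y

/-- The subspace of the `k`-th exterior power of `V` spanned by the pure wedges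
`v₁ ∧ ⋯ ∧ v_k` where `v₁, …, v_k` is a basis of a `k`-dimensional subspace satisfying `P`,
all of whose vectors lie in `U`. -/
def grassmannIn (P : Submodule F V → Prop) (U : Submodule F V) (k : ℕ) :
    Submodule F (ExteriorAlgebra F V) :=
  Submodule.span F {x | ∃ v : Fin k → V, (∀ t, v t ∈ U) ∧ LinearIndependent F v ∧
    P (Submodule.span F (Set.range v)) ∧ x = ExteriorAlgebra.ιMulti F k v}

/-- The Grassmann image: the subspace of the `k`-th exterior power of `V` spanned by the
pure wedges of bases of `k`-dimensional subspaces of `V` satisfying `P`. -/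
def grassmann (P : Submodule F V → Prop) (k : ℕ) : Submodule F (ExteriorAlgebra F V) :=
  grassmannIn F V P ⊤ k

/-- `B` is a `σ`-Hermitian form. -/
def IsHermitianForm (σ : F ≃+* F) (B : V → V → F) : Prop :=
  (∀ x y z : V, B (x + y) z = B x z + B y z) ∧
  (∀ x y z : V, B x (y + z) = B x y + B x z) ∧
  (∀ (a b : F) (x y : V), B (a • x) (b • y) = σ a * b * B x y) ∧
  (∀ x y : V, B y x = σ (B x y))

/-- `B` is an alternating bilinear form. -/
def IsAlternatingForm (B : V → V → F) : Prop :=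
  (∀ x y z : V, B (x + y) z = B x z + B y z) ∧
  (∀ x y z : V, B x (y + z) = B x y + B x z) ∧
  (∀ (a : F) (x y : V), B (a • x) y = a * B x y) ∧
  (∀ (a : F) (x y : V), B x (a • y) = a * B x y) ∧
  (∀ x : V, B x x = 0)

/-- `V` is the orthogonal (w.r.t. the pairing `B`) direct sum of the subspaces
`W 0, …, W (n-1), W₀, R`, where each `W i` is a hyperbolic plane (spanned by two singular
vectors pairing to `1`, singularity being measured by `sv`), `W₀` is anisotropic of
dimension `d₀` (it contains no nonzero singular vector) and `R` is the radical
(given as the set `RadSet`) and has dimension `d`. -/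
def IsWittDecomp (B : V → V → F) (sv : V → Prop) (RadSet : Set V) (n d₀ d : ℕ)
    (W : Fin n → Submodule F V) (W₀ R : Submodule F V) : Prop :=
  DirectSum.IsInternal (Sum.elim W ![W₀, R]) ∧
  (∀ j j' : Fin n ⊕ Fin 2, j ≠ j' →
    ∀ x ∈ Sum.elim W ![W₀, R] j, ∀ y ∈ Sum.elim W ![W₀, R] j', B x y = 0) ∧
  (∀ i : Fin n, ∃ e f : V, W i = Submodule.span F {e, f} ∧ sv e ∧ sv f ∧ B e f = 1) ∧
  (∀ v ∈ W₀, v ≠ 0 → ¬ sv v) ∧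
  Module.finrank F W₀ = d₀ ∧
  (R : Set V) = RadSet ∧
  Module.finrank F R = d

/-- There is a Witt decomposition of `V` as above: `B` has reduced Witt index `n`,
anisotropic defect `d₀` and singular defect `d`. -/
def HasWittDecomp (B : V → V → F) (sv : V → Prop) (RadSet : Set V) (n d₀ d : ℕ) : Prop :=
  ∃ (W : Fin n → Submodule F V) (W₀ R : Submodule F V),
    IsWittDecomp F V B sv RadSet n d₀ d W W₀ R

/-- The radical (as a set) of a sesquilinear/bilinear pairing. -/
def radSetB (B : V → V → F) : Set V := {v | ∀ w, B v w = 0}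

/-- The radical (as a set) of a quadratic form. -/
def radSetQ (q : QuadraticForm F V) : Set V :=
  {v | q v = 0 ∧ ∀ w, polarF F V q v w = 0}

/-- The image of `⋀^i U` inside the exterior algebra of `V`: the span of the pure wedges of
`i`-tuples of vectors of `U`. -/
def extPowOf (U : Submodule F V) (i : ℕ) : Submodule F (ExteriorAlgebra F V) :=
  Submodule.span F {x | ∃ v : Fin i → V, (∀ t, v t ∈ U) ∧ x = ExteriorAlgebra.ιMulti F i v}

/-- `Ḡ_j`: for `j ≥ 1` the span of the pure wedges of bases of `j`-dimensional subspaces of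
`U` satisfying `P`; for `j = 0` the scalars `F ⊆ ⋀^0 V`. -/
def gbar (P : Submodule F V → Prop) (U : Submodule F V) : ℕ → Submodule F (ExteriorAlgebra F V)
  | 0 => 1
  | (j + 1) => grassmannIn F V P U (j + 1)

end PolarGrass

namespace PolarGrass

section Ext

open Module

variable {F : Type*} [Field F] {V : Type*} [AddCommGroup V] [Module F V]

/-- contraction by a functional on the exterior algebra -/
def con (d : Module.Dual F V) : ExteriorAlgebra F V →ₗ[F] ExteriorAlgebra F V :=
  CliffordAlgebra.contractLeft (Q := (0 : QuadraticForm F V)) d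

theorem con_mul (d : Module.Dual F V) (a : V) (b : ExteriorAlgebra F V) :
    con d (ExteriorAlgebra.ι F a * b) = d a • b - ExteriorAlgebra.ι F a * con d b :=
  CliffordAlgebra.contractLeft_ι_mul (Q := (0 : QuadraticForm F V)) d a b

theorem con_algebraMap (d : Module.Dual F V) (r : F) :
    con d (algebraMap F (ExteriorAlgebra F V) r) = 0 :=
  CliffordAlgebra.contractLeft_algebraMap (0 : QuadraticForm F V) d r

theorem alt_proof (B : LinearMap.BilinForm F V) (hB : B.IsAlt) :
    B.toQuadraticMap = (0 : QuadraticForm F V) - 0 := by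
  ext x
  simpa using hB x

/-- exponential of the contraction with an alternating form -/
def Phi (B : LinearMap.BilinForm F V) (hB : B.IsAlt) :
    ExteriorAlgebra F V →ₗ[F] ExteriorAlgebra F V :=
  CliffordAlgebra.changeForm (alt_proof B hB)

variable (B : LinearMap.BilinForm F V) (hB : B.IsAlt)

theorem Phi_algebraMap (r : F) :
    Phi B hB (algebraMap F (ExteriorAlgebra F V) r) = algebraMap F (ExteriorAlgebra F V) r :=
  CliffordAlgebra.changeForm_algebraMap (alt_proof B hB) r

theorem Phi_mul (a : V) (b : ExteriorAlgebra F V) :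
    Phi B hB (ExteriorAlgebra.ι F a * b) =
      ExteriorAlgebra.ι F a * Phi B hB b - con (B a) (Phi B hB b) :=
  CliffordAlgebra.changeForm_ι_mul (alt_proof B hB) a b

theorem Phi_con (d : Module.Dual F V) (b : ExteriorAlgebra F V) :
    Phi B hB (con d b) = con d (Phi B hB b) :=
  CliffordAlgebra.changeForm_contractLeft (alt_proof B hB) d b

/-- The `k`-th exterior power of `U` inside the exterior algebra of `V`. -/
def EP (U : Submodule F V) (k : ℕ) : Submodule F (ExteriorAlgebra F V) :=
  (U.map (ExteriorAlgebra.ι F)) ^ k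

theorem EP_induct {U : Submodule F V} {C : ℕ → ExteriorAlgebra F V → Prop}
    (h0 : ∀ r : F, C 0 (algebraMap _ _ r))
    (hadd : ∀ x y i, C i x → C i y → C i (x + y))
    (hmul : ∀ u ∈ U, ∀ i x, x ∈ EP U i → C i x → C (i+1) (ExteriorAlgebra.ι F u * x))
    {k : ℕ} {x : ExteriorAlgebra F V} (hx : x ∈ EP U k) : C k x := by
  refine Submodule.pow_induction_on_left' (U.map (ExteriorAlgebra.ι F)) (C := fun k x _ => C k x) h0 ?_ ?_ hx
  · intro x y i _ _ h1 h2
    exact hadd x y i h1 h2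
  · rintro m ⟨u, hu, rfl⟩ i x hx h
    exact hmul u hu i x hx h

theorem EP_mul {U : Submodule F V} {u : V} (hu : u ∈ U) {k : ℕ} {x : ExteriorAlgebra F V}
    (hx : x ∈ EP U k) : ExteriorAlgebra.ι F u * x ∈ EP U (k+1) := by
  unfold EP at *
  rw [pow_succ']
  exact Submodule.mul_mem_mul (Submodule.mem_map_of_mem hu) hx

theorem EP_mono {U U' : Submodule F V} (h : U ≤ U') (k : ℕ) : EP U k ≤ EP U' k :=
  pow_le_pow_left' (Submodule.map_mono h) k

theorem EP_zero_mem (U : Submodule F V) (r : F) :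
    algebraMap F (ExteriorAlgebra F V) r ∈ EP U 0 := by
  unfold EP
  rw [pow_zero]
  exact Submodule.algebraMap_mem r

theorem EP_zero_exists {U : Submodule F V} {x : ExteriorAlgebra F V} (h : x ∈ EP U 0) :
    ∃ r : F, x = algebraMap F (ExteriorAlgebra F V) r := by
  unfold EP at h
  rw [pow_zero] at h
  obtain ⟨r, hr⟩ := Submodule.mem_one.mp h
  exact ⟨r, hr.symm⟩

theorem EP_finite [FiniteDimensional F V] (U : Submodule F V) (k : ℕ) :
    FiniteDimensional F (EP U k) := by
  refine Module.Finite.iff_fg.mpr ?_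
  exact Submodule.FG.pow (Submodule.FG.map _ (IsNoetherian.noetherian U)) k

theorem con_EP_zero {U : Submodule F V} {d : Module.Dual F V} (hd : ∀ u ∈ U, d u = 0)
    {k : ℕ} {x : ExteriorAlgebra F V} (hx : x ∈ EP U k) : con d x = 0 := by
  refine EP_induct (C := fun _ x => con d x = 0) ?_ ?_ ?_ hx
  · intro r; exact con_algebraMap d r
  · intro x y i h1 h2; rw [map_add, h1, h2, add_zero]
  · intro u hu i x _ h
    rw [con_mul, hd u hu, h]; simp

theorem con_EP (d : Module.Dual F V) {U : Submodule F V} {k : ℕ} {x : ExteriorAlgebra F V}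
    (hx : x ∈ EP U k) : con d x ∈ EP U (k - 1) := by
  refine (EP_induct (C := fun k x => (k = 0 → con d x = 0) ∧ con d x ∈ EP U (k-1))
    ?_ ?_ ?_ hx).2
  · intro r; rw [con_algebraMap]; exact ⟨fun _ => rfl, zero_mem _⟩
  · intro x y i h1 h2; rw [map_add]
    exact ⟨fun h => by rw [h1.1 h, h2.1 h, add_zero], add_mem h1.2 h2.2⟩
  · intro u hu i x hx h
    refine ⟨fun h => by omega, ?_⟩
    rw [con_mul]
    refine sub_mem (Submodule.smul_mem _ _ hx) ?_
    rcases i with _ | i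
    · rw [h.1 rfl, mul_zero]; exact zero_mem _
    · exact EP_mul hu h.2

theorem iota_swap (u e : V) (b : ExteriorAlgebra F V) :
    ExteriorAlgebra.ι F u * (ExteriorAlgebra.ι F e * b) =
      - (ExteriorAlgebra.ι F e * (ExteriorAlgebra.ι F u * b)) := by
  rw [← mul_assoc, ← mul_assoc, eq_neg_iff_add_eq_zero, ← add_mul,
    ExteriorAlgebra.ι_add_mul_swap, zero_mul]

theorem iota_sq (e : V) (b : ExteriorAlgebra F V) :
    ExteriorAlgebra.ι F e * (ExteriorAlgebra.ι F e * b) = 0 := by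
  rw [← mul_assoc, ExteriorAlgebra.ι_sq_zero, zero_mul]

theorem EP_sup {U : Submodule F V} {e : V} {k : ℕ} {x : ExteriorAlgebra F V}
    (hx : x ∈ EP (U ⊔ Submodule.span F {e}) (k+1)) :
    ∃ a ∈ EP U (k+1), ∃ b ∈ EP U k, x = a + ExteriorAlgebra.ι F e * b := by
  have key := EP_induct (U := U ⊔ Submodule.span F {e})
    (C := fun k x => ∃ a ∈ EP U k, ∃ b ∈ EP U (k-1), (k = 0 → b = 0) ∧
      x = a + ExteriorAlgebra.ι F e * b) ?_ ?_ ?_ hx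
  · obtain ⟨a, ha, b, hb, -, h⟩ := key
    exact ⟨a, ha, b, hb, h⟩
  · intro r
    exact ⟨_, EP_zero_mem U r, 0, zero_mem _, fun _ => rfl, by simp⟩
  · rintro x y i ⟨a, ha, b, hb, h0, rfl⟩ ⟨a', ha', b', hb', h0', rfl⟩
    refine ⟨a + a', add_mem ha ha', b + b', add_mem hb hb', ?_, ?_⟩
    · intro h; rw [h0 h, h0' h, add_zero]
    · rw [mul_add]; abel
  · rintro w hw i x - ⟨a, ha, b, hb, h0, rfl⟩
    obtain ⟨u, hu, v, hv, rfl⟩ := Submodule.mem_sup.mp hw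
    obtain ⟨c, rfl⟩ := Submodule.mem_span_singleton.mp hv
    refine ⟨ExteriorAlgebra.ι F u * a, EP_mul hu ha, c • a - ExteriorAlgebra.ι F u * b,
      sub_mem (Submodule.smul_mem _ _ ha) ?_, fun h => by omega, ?_⟩
    · rcases i with _ | i
      · rw [h0 rfl, mul_zero]; exact zero_mem _
      · exact EP_mul hu hb
    · rw [map_add, map_smul, add_mul, mul_add, mul_add, iota_swap, smul_mul_assoc,
        smul_mul_assoc, iota_sq, mul_sub, mul_smul_comm]
      simp only [smul_zero]
      abel

/-- Elements of degree `k` on `U` fixed by `Phi`. -/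
def KK (U : Submodule F V) (k : ℕ) : Submodule F (ExteriorAlgebra F V) :=
  EP U k ⊓ LinearMap.ker (Phi B hB - LinearMap.id)

theorem mem_KK {U : Submodule F V} {k : ℕ} {x : ExteriorAlgebra F V} :
    x ∈ KK B hB U k ↔ x ∈ EP U k ∧ Phi B hB x = x := by
  unfold KK
  rw [Submodule.mem_inf, LinearMap.mem_ker, LinearMap.sub_apply, LinearMap.id_apply, sub_eq_zero]

theorem finrank_split {E E' : Type*} [AddCommGroup E] [Module F E] [AddCommGroup E'] [Module F E']
    (X : Submodule F E) [FiniteDimensional F X] (g : E →ₗ[F] E') :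
    finrank F X = finrank F (X.map g) + finrank F (X ⊓ LinearMap.ker g : Submodule F E) := by
  have h := (g.domRestrict X).finrank_range_add_finrank_ker
  rw [LinearMap.range_domRestrict] at h
  rw [← h]
  congr 1
  rw [LinearMap.ker_domRestrict, ← Submodule.finrank_map_subtype_eq X (Submodule.comap _ _),
    Submodule.map_comap_subtype]

theorem KK_step [FiniteDimensional F V] (U : Submodule F V) (e : V) (d : Module.Dual F V)
    (hd : ∀ u ∈ U, d u = 0) (hde : d e = 1) (k : ℕ) :
    finrank F (KK B hB (U ⊔ Submodule.span F {e}) (k+1)) ≤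
      finrank F (KK B hB U (k+1)) + finrank F (KK B hB U k) := by
  have := EP_finite (F := F) (V := V)
  have fin : ∀ U k, FiniteDimensional F (KK B hB U k) := fun U k =>
    Submodule.finiteDimensional_of_le (inf_le_left : KK B hB U k ≤ EP U k)
  rw [finrank_split _ (con d), add_comm]
  refine add_le_add (Submodule.finrank_mono ?_) (Submodule.finrank_mono ?_)
  · rintro x ⟨hx, hxd⟩
    rw [SetLike.mem_coe, mem_KK] at hx
    obtain ⟨h1, h2⟩ := hx
    obtain ⟨a, ha, b, hb, rfl⟩ := EP_sup h1
    have h3 : con d (a + ExteriorAlgebra.ι F e * b) = 0 := hxd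
    rw [map_add, con_EP_zero hd ha, con_mul, con_EP_zero hd hb, hde] at h3
    simp at h3
    subst h3
    rw [mul_zero, add_zero] at *
    exact (mem_KK B hB).2 ⟨ha, h2⟩
  · rintro _ ⟨x, hx, rfl⟩
    rw [SetLike.mem_coe, mem_KK] at hx
    obtain ⟨h1, h2⟩ := hx
    refine (mem_KK B hB).2 ⟨?_, by rw [Phi_con, h2]⟩
    obtain ⟨a, ha, b, hb, rfl⟩ := EP_sup h1
    rw [map_add, con_EP_zero hd ha, con_mul, con_EP_zero hd hb, hde]
    simpa using hb

theorem KK_zero (U : Submodule F V) : finrank F (KK B hB U 0) ≤ 1 := by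
  have : KK B hB U 0 ≤ Submodule.span F {1} := by
    intro x hx
    obtain ⟨r, rfl⟩ := EP_zero_exists ((mem_KK B hB).1 hx).1
    rw [Algebra.algebraMap_eq_smul_one]
    exact Submodule.smul_mem _ _ (Submodule.mem_span_singleton_self _)
  exact (Submodule.finrank_mono this).trans (finrank_span_le_card _ |>.trans (by simp))

theorem EP_bot (k : ℕ) : EP (⊥ : Submodule F V) (k+1) = ⊥ := by
  unfold EP
  rw [Submodule.map_bot, pow_succ, Submodule.mul_bot]

/-- the degree filtration -/
def Fil (s : ℕ) : Submodule F (ExteriorAlgebra F V) := ⨆ j : ℕ, EP (⊤ : Submodule F V) (s + j)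

theorem EP_le_Fil (U : Submodule F V) {k s : ℕ} (h : s ≤ k) : EP U k ≤ Fil s := by
  refine (EP_mono le_top k).trans ?_
  obtain ⟨j, rfl⟩ := Nat.exists_eq_add_of_le h
  exact le_iSup (fun j => EP (⊤ : Submodule F V) (s + j)) j

theorem Fil_mono {s t : ℕ} (h : s ≤ t) : (Fil t : Submodule F (ExteriorAlgebra F V)) ≤ Fil s :=
  iSup_le fun j => EP_le_Fil ⊤ (by omega)

theorem Fil_mul (v : V) {s : ℕ} {x : ExteriorAlgebra F V} (hx : x ∈ Fil s) :
    ExteriorAlgebra.ι F v * x ∈ Fil (s+1) := by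
  have : (Fil s : Submodule F (ExteriorAlgebra F V)) ≤
      (Fil (s+1)).comap (LinearMap.mulLeft F (ExteriorAlgebra.ι F v)) := by
    refine iSup_le fun j x hx => ?_
    exact EP_le_Fil ⊤ (by omega) (EP_mul (Submodule.mem_top (x := v)) hx)
  exact this hx

theorem Fil_con (d : Module.Dual F V) {s : ℕ} {x : ExteriorAlgebra F V} (hx : x ∈ Fil s) :
    con d x ∈ Fil (s-1) := by
  have : (Fil s : Submodule F (ExteriorAlgebra F V)) ≤ (Fil (s-1)).comap (con d) := by
    refine iSup_le fun j x hx => ?_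
    exact EP_le_Fil ⊤ (by omega) (con_EP d hx)
  exact this hx

theorem Fil_zero (x : ExteriorAlgebra F V) : x ∈ (Fil 0 : Submodule F (ExteriorAlgebra F V)) := by
  induction x using CliffordAlgebra.left_induction with
  | algebraMap r => exact EP_le_Fil ⊤ le_rfl (EP_zero_mem ⊤ r)
  | add x y hx hy => exact add_mem hx hy
  | ι_mul x m hx => exact Fil_mono (Nat.zero_le 1) (Fil_mul m hx)

theorem Fil_one_algebraMap {r : F} (h : algebraMap F (ExteriorAlgebra F V) r ∈ Fil 1) : r = 0 := by
  have : (Fil 1 : Submodule F (ExteriorAlgebra F V)) ≤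
      LinearMap.ker (ExteriorAlgebra.algebraMapInv (R := F) (M := V)).toLinearMap := by
    refine iSup_le fun j x hx => ?_
    rw [add_comm] at hx
    have := EP_induct (C := fun k x => k ≠ 0 → (ExteriorAlgebra.algebraMapInv (R := F) (M := V)) x = 0)
      (fun r h => absurd rfl h) (fun x y i h1 h2 h => by rw [map_add, h1 h, h2 h, add_zero])
      (fun u hu i x hx h _ => by
        rw [map_mul]
        simp [ExteriorAlgebra.algebraMapInv]) hx
    exact this (by omega)
  have h2 := this h
  simpa using h2

end Ext
end PolarGrass
namespace PolarGrass

section Upper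

open Module

variable {F : Type*} [Field F] {V : Type*} [AddCommGroup V] [Module F V]
variable (B : LinearMap.BilinForm F V)

/-- Subspaces that are built from `m` orthogonal hyperbolic planes. -/
inductive Symp : ℕ → Submodule F V → Prop
  | bot : Symp 0 ⊥
  | hyp {m : ℕ} {U : Submodule F V} {e f : V} : Symp m U → (∀ u ∈ U, B e u = 0) →
      (∀ u ∈ U, B f u = 0) → B e f = 1 →
      Symp (m+1) (U ⊔ Submodule.span F {f} ⊔ Submodule.span F {e})

/-- Subspaces that are built from `m` hyperbolic planes and an `r`-dimensional radical. -/
inductive Exd (m : ℕ) : ℕ → Submodule F V → Prop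
  | base {U : Submodule F V} : Symp B m U → Exd m 0 U
  | rad {r : ℕ} {U : Submodule F V} {x : V} : Exd m r U → x ∉ U → (∀ u ∈ U, B x u = 0) →
      Exd m (r+1) (U ⊔ Submodule.span F {x})

variable {B}
variable (hB : B.IsAlt)

/-- shifted exterior power -/
def EPs (U : Submodule F V) (k j : ℕ) (c : ExteriorAlgebra F V) : Prop :=
  c = 0 ∨ ∃ k1, k = k1 + j ∧ c ∈ EP U k1

theorem EP_sup' {U : Submodule F V} {e : V} {k : ℕ} {x : ExteriorAlgebra F V}
    (hx : x ∈ EP (U ⊔ Submodule.span F {e}) k) :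
    ∃ a ∈ EP U k, ∃ b, EPs U k 1 b ∧ x = a + ExteriorAlgebra.ι F e * b := by
  rcases k with _ | k
  · obtain ⟨r, rfl⟩ := EP_zero_exists hx
    exact ⟨_, EP_zero_mem U r, 0, Or.inl rfl, by simp⟩
  · obtain ⟨a, ha, b, hb, rfl⟩ := EP_sup hx
    exact ⟨a, ha, b, Or.inr ⟨k, rfl, hb⟩, rfl⟩

theorem EP_sup2 {U : Submodule F V} {e f : V} {k : ℕ} {x : ExteriorAlgebra F V}
    (hx : x ∈ EP (U ⊔ Submodule.span F {f} ⊔ Submodule.span F {e}) k) :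
    ∃ a ∈ EP U k, ∃ c, EPs U k 1 c ∧ ∃ b, EPs U k 1 b ∧ ∃ d, EPs U k 2 d ∧
      x = a + ExteriorAlgebra.ι F f * c +
        ExteriorAlgebra.ι F e * (b + ExteriorAlgebra.ι F f * d) := by
  obtain ⟨y, hy, z, hz, rfl⟩ := EP_sup' hx
  obtain ⟨a, ha, c, hc, rfl⟩ := EP_sup' hy
  rcases hz with rfl | ⟨k1, rfl, hz⟩
  · exact ⟨a, ha, c, hc, 0, Or.inl rfl, 0, Or.inl rfl, by simp⟩
  · obtain ⟨b, hb, d, hd, rfl⟩ := EP_sup' hz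
    refine ⟨a, ha, c, hc, b, Or.inr ⟨_, rfl, hb⟩, d, ?_, rfl⟩
    rcases hd with rfl | ⟨k2, rfl, hd⟩
    · exact Or.inl rfl
    · exact Or.inr ⟨k2, rfl, hd⟩

theorem con_EPs_zero {U : Submodule F V} {d : Module.Dual F V} (hd : ∀ u ∈ U, d u = 0)
    {k j : ℕ} {x : ExteriorAlgebra F V} (hx : EPs U k j x) : con d x = 0 := by
  rcases hx with rfl | ⟨k1, rfl, hx⟩
  · simp
  · exact con_EP_zero hd hx

theorem alt_swap {B : LinearMap.BilinForm F V} (hB : B.IsAlt) (x y : V) : B x y = - B y x := by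
  have := LinearMap.IsAlt.neg hB x y
  rw [← this, neg_neg]

theorem Q_lemma {m : ℕ} {U : Submodule F V} (hU : Symp B m U) :
    ∀ (k s : ℕ) (x : ExteriorAlgebra F V), x ∈ EP U k → Phi B hB x ∈ Fil s →
      2 * m < k + s → x = 0 := by
  induction hU with
  | bot =>
    intro k s x hx hs hks
    rcases k with _ | k
    · obtain ⟨r, rfl⟩ := EP_zero_exists hx
      rw [Phi_algebraMap] at hs
      rw [Fil_one_algebraMap (Fil_mono (by omega) hs), map_zero]
    · rw [EP_bot] at hx
      simpa using hx
  | @hyp m U e f hU he hf hef ih =>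
    intro k s x hx hs hks
    have ih' : ∀ (j t : ℕ) (y : ExteriorAlgebra F V), EPs U k j y → Phi B hB y ∈ Fil t →
      2 * m + j < k + t → y = 0 := by
      rintro j t y (rfl | ⟨k1, rfl, hy⟩) ht hh
      · rfl
      · exact ih _ _ y hy ht (by omega)
    obtain ⟨a, ha, c, hc, b, hb, d, hd, rfl⟩ := EP_sup2 hx
    have hfe : B f e = -1 := by rw [alt_swap hB, hef]
    have hf' : ∀ u ∈ U, (-B f) u = 0 := fun u hu => by simp [hf u hu]
    set y := b + ExteriorAlgebra.ι F f * d with hy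
    set x := a + ExteriorAlgebra.ι F f * c + ExteriorAlgebra.ι F e * y with hxd
    have hff : B f f = 0 := hB f
    have hee : B e e = 0 := hB e
    have h1 : con (-B f) y = 0 := by
      rw [hy, map_add, con_EPs_zero hf' hb, con_mul, con_EPs_zero hf' hd]
      simp [hff]
    have h2 : con (-B f) x = y := by
      rw [hxd, map_add, map_add, con_EP_zero hf' ha, con_mul, con_EPs_zero hf' hc, con_mul, h1]
      simp [hff, hfe]
    have h3 : con (B e) y = d := by
      rw [hy, map_add, con_EPs_zero he hb, con_mul, con_EPs_zero he hd]
      simp [hef]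
    have h4 : con (B e) x = c - ExteriorAlgebra.ι F e * d := by
      rw [hxd, map_add, map_add, con_EP_zero he ha, con_mul, con_EPs_zero he hc, con_mul, h3]
      simp [hef, hee, sub_eq_add_neg]
    have hPy : Phi B hB y ∈ Fil (s-1) := by
      rw [← h2, Phi_con]; exact Fil_con _ hs
    have hPd : Phi B hB d ∈ Fil (s-2) := by
      rw [← h3, Phi_con]; exact Fil_con _ hPy
    have hfd : Phi B hB (ExteriorAlgebra.ι F f * d) = ExteriorAlgebra.ι F f * Phi B hB d := by
      rw [Phi_mul, ← Phi_con, con_EPs_zero hf hd]; simp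
    have hed : Phi B hB (ExteriorAlgebra.ι F e * d) = ExteriorAlgebra.ι F e * Phi B hB d := by
      rw [Phi_mul, ← Phi_con, con_EPs_zero he hd]; simp
    have hb0 : b = 0 := by
      refine ih' 1 (s-1) b hb ?_ (by omega)
      have : b = y - ExteriorAlgebra.ι F f * d := by rw [hy]; abel
      rw [this, map_sub, hfd]
      exact sub_mem hPy (Fil_mono (by omega) (Fil_mul f hPd))
    have hc0 : c = 0 := by
      refine ih' 1 (s-1) c hc ?_ (by omega)
      have : c = con (B e) x + ExteriorAlgebra.ι F e * d := by rw [h4]; abel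
      rw [this, map_add, hed, Phi_con]
      exact add_mem (Fil_con _ hs) (Fil_mono (by omega) (Fil_mul e hPd))
    have hefd : Phi B hB (ExteriorAlgebra.ι F e * (ExteriorAlgebra.ι F f * d)) =
        ExteriorAlgebra.ι F e * (ExteriorAlgebra.ι F f * Phi B hB d) - Phi B hB d := by
      rw [Phi_mul, hfd, con_mul, ← Phi_con B hB (B e) d, con_EPs_zero he hd]
      simp [hef]
    have hxe : x = a + ExteriorAlgebra.ι F e * (ExteriorAlgebra.ι F f * d) := by
      rw [hxd, hy, hb0, hc0]; simp
    have hPefd : ExteriorAlgebra.ι F e * (ExteriorAlgebra.ι F f * Phi B hB d) ∈ Fil s :=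
      Fil_mono (by omega) (Fil_mul e (Fil_mul f hPd))
    have ha0 : a = 0 := by
      refine ih k (s-2) a ha ?_ (by omega)
      have : a = x - ExteriorAlgebra.ι F e * (ExteriorAlgebra.ι F f * d) := by rw [hxe]; abel
      rw [this, map_sub, hefd]
      exact sub_mem (Fil_mono (by omega) hs) (sub_mem (Fil_mono (by omega) hPefd) hPd)
    have hd0 : d = 0 := by
      refine ih' 2 s d hd ?_ (by omega)
      have : Phi B hB d = ExteriorAlgebra.ι F e * (ExteriorAlgebra.ι F f * Phi B hB d) -
          Phi B hB x := by
        rw [hxe, ha0, zero_add, hefd]; abel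
      rw [this]
      exact sub_mem hPefd hs
    rw [hxe, ha0, hd0]; simp

/-- `N.choose (k-2)` with the convention that it vanishes for `k < 2`. -/
def c2 (N k : ℕ) : ℕ := if 2 ≤ k then N.choose (k-2) else 0

theorem c2_succ (N k : ℕ) : c2 (N+1) (k+1) = c2 N k + c2 N (k+1) := by
  unfold c2
  rcases k with _ | _ | k
  · simp
  · simp
  · rw [if_pos (by omega), if_pos (by omega), if_pos (by omega)]
    exact Nat.choose_succ_succ N k

theorem c2_le (m : ℕ) : c2 (2*m) (m+1) ≤ (2*m).choose (m+1) := by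
  unfold c2
  rcases m with _ | m
  · simp
  · rw [if_pos (by omega)]
    rw [← Nat.choose_symm_of_eq_add (n := 2*(m+1)) (a := m+1+1) (b := m+1+1-2) (by omega)]

theorem upper_step [FiniteDimensional F V] {U : Submodule F V} {N K : ℕ}
    (h : ∀ k ≤ K, finrank F (KK B hB U k) + c2 N k ≤ N.choose k)
    (e : V) (d : Module.Dual F V) (hd : ∀ u ∈ U, d u = 0) (hde : d e = 1) :
    ∀ k ≤ K, finrank F (KK B hB (U ⊔ Submodule.span F {e}) k) + c2 (N+1) k ≤ (N+1).choose k := by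
  intro k hk
  rcases k with _ | k
  · have := KK_zero B hB (U ⊔ Submodule.span F {e})
    simpa [c2] using this
  · have h1 := KK_step B hB U e d hd hde k
    have h2 := h k (by omega)
    have h3 := h (k+1) hk
    rw [c2_succ, Nat.choose_succ_succ']
    omega

theorem upper_symp [FiniteDimensional F V] {m : ℕ} {U : Submodule F V} (hU : Symp B m U) :
    ∀ k ≤ m+1, finrank F (KK B hB U k) + c2 (2*m) k ≤ (2*m).choose k := by
  have key : ∀ {m : ℕ} {U : Submodule F V} (hU : Symp B m U),
      finrank F (KK B hB U (m+1)) + c2 (2*m) (m+1) ≤ (2*m).choose (m+1) := by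
    intro m U hU
    have : KK B hB U (m+1) = ⊥ := by
      rw [eq_bot_iff]
      intro x hx
      obtain ⟨h1, h2⟩ := (mem_KK B hB).1 hx
      refine (Submodule.mem_bot _).2 (Q_lemma hB hU (m+1) (m+1) x h1 ?_ (by omega))
      rw [h2]
      exact EP_le_Fil U le_rfl h1
    rw [this, finrank_bot, zero_add]
    exact c2_le m
  induction hU with
  | bot =>
    intro k hk
    rcases Nat.lt_or_ge k 1 with h | h
    · obtain rfl : k = 0 := by omega
      have := KK_zero B hB (⊥ : Submodule F V)
      simpa [c2] using this
    · obtain rfl : k = 1 := by omega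
      exact key Symp.bot
  | @hyp m U e f hU he hf hef ih =>
    intro k hk
    rcases Nat.lt_or_ge k (m+2) with h | h
    · have hfe : B f e = -1 := by rw [alt_swap hB, hef]
      have s1 := upper_step hB ih f (B e) he hef
      have s2 := upper_step hB s1 e (-B f) ?_ (by simp [hfe])
      · exact s2 k (by omega)
      · intro u hu
        obtain ⟨u', hu', v, hv, rfl⟩ := Submodule.mem_sup.mp hu
        obtain ⟨c, rfl⟩ := Submodule.mem_span_singleton.mp hv
        simp [hf u' hu', hB f]
    · obtain rfl : k = m+1+1 := by omega
      exact key (Symp.hyp hU he hf hef)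

theorem exists_dual {U : Submodule F V} {x : V} (hx : x ∉ U) :
    ∃ d : Module.Dual F V, (∀ u ∈ U, d u = 0) ∧ d x = 1 := by
  obtain ⟨d, hd, hU⟩ := Submodule.exists_le_ker_of_notMem hx
  refine ⟨(d x)⁻¹ • d, fun u hu => ?_, ?_⟩
  · have : d u = 0 := hU hu
    simp [this]
  · simp [hd]

theorem upper_exd [FiniteDimensional F V] {m r : ℕ} {U : Submodule F V} (hU : Exd B m r U) :
    ∀ k ≤ m+1, finrank F (KK B hB U k) + c2 (2*m+r) k ≤ (2*m+r).choose k := by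
  induction hU with
  | base h => exact upper_symp hB h
  | rad _ hx _ ih =>
    obtain ⟨d, h1, h2⟩ := exists_dual hx
    exact upper_step hB ih _ d h1 h2

theorem finrank_exd [FiniteDimensional F V] (hB : B.IsAlt) {m r : ℕ} {U : Submodule F V}
    (hU : Exd B m r U) : finrank F U = 2*m+r := by
  induction hU with
  | base h =>
    induction h with
    | bot => simp
    | @hyp m U e f hU he hf hef ih =>
      have hfe : B f e = -1 := by rw [alt_swap hB, hef]
      rw [Submodule.finrank_sup_span_singleton, Submodule.finrank_sup_span_singleton, ih]
      · omega
      · intro h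
        have := he f h
        rw [hef] at this
        exact one_ne_zero this
      · intro hu
        have : B f e = 0 := by
          obtain ⟨u', hu', v, hv, h⟩ := Submodule.mem_sup.mp hu
          obtain ⟨c, rfl⟩ := Submodule.mem_span_singleton.mp hv
          rw [← h]
          simp [hf u' hu', hB f]
        rw [hfe] at this
        simp at this
  | rad _ hx _ ih =>
    rw [Submodule.finrank_sup_span_singleton hx, ih]; omega

end Upper
end PolarGrass
namespace PolarGrass

section Lower

open Module

variable {F : Type*} [Field F] {V : Type*} [AddCommGroup V] [Module F V]
variable {B : LinearMap.BilinForm F V} 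

/-- symplectic Grassmann image inside `U` -/
def SS (B : LinearMap.BilinForm F V) (U : Submodule F V) (k : ℕ) :
    Submodule F (ExteriorAlgebra F V) :=
  grassmannIn F V (TotSingB F V (fun x y => B x y)) U k

theorem totSing_span {k : ℕ} {v : Fin k → V} (h : ∀ i j, B (v i) (v j) = 0) :
    TotSingB F V (fun x y => B x y) (Submodule.span F (Set.range v)) := by
  intro x hx y hy
  induction hx, hy using Submodule.span_induction₂ with
  | mem_mem x y hx hy =>
    obtain ⟨i, rfl⟩ := hx
    obtain ⟨j, rfl⟩ := hy
    exact h i j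
  | zero_left => simp
  | zero_right => simp
  | add_left x y z _ _ _ h1 h2 => simp_all
  | add_right x y z _ _ _ h1 h2 => simp_all
  | smul_left => simp_all
  | smul_right => simp_all

theorem mem_SS {U : Submodule F V} {k : ℕ} {v : Fin k → V} (hU : ∀ i, v i ∈ U)
    (h : ∀ i j, B (v i) (v j) = 0) : ExteriorAlgebra.ιMulti F k v ∈ SS B U k := by
  by_cases hv : LinearIndependent F v
  · exact Submodule.subset_span ⟨v, hU, hv, totSing_span h, rfl⟩
  · rw [AlternatingMap.map_linearDependent _ v hv]
    exact zero_mem _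

theorem SS_le {U : Submodule F V} {k : ℕ} {X : Submodule F (ExteriorAlgebra F V)}
    (h : ∀ v : Fin k → V, (∀ i, v i ∈ U) → (∀ i j, B (v i) (v j) = 0) →
      ExteriorAlgebra.ιMulti F k v ∈ X) : SS B U k ≤ X := by
  refine Submodule.span_le.2 ?_
  rintro x ⟨v, hv, -, ht, rfl⟩
  exact h v hv fun i j => ht _ (Submodule.subset_span ⟨i, rfl⟩) _ (Submodule.subset_span ⟨j, rfl⟩)

theorem iM_cons {k : ℕ} (x : V) (v : Fin k → V) :
    ExteriorAlgebra.ιMulti F (k+1) (Fin.cons x v : Fin (k+1) → V) =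
      ExteriorAlgebra.ι F x * ExteriorAlgebra.ιMulti F k v := by
  rw [ExteriorAlgebra.ιMulti_succ_apply]
  congr 1

theorem iM_mem_EP {U : Submodule F V} {k : ℕ} {v : Fin k → V} (hU : ∀ i, v i ∈ U) :
    ExteriorAlgebra.ιMulti F k v ∈ EP U k := by
  induction k with
  | zero =>
    rw [ExteriorAlgebra.ιMulti_zero_apply]
    simpa using EP_zero_mem U (1:F)
  | succ k ih =>
    rw [← Fin.cons_self_tail v, iM_cons]
    exact EP_mul (hU 0) (ih fun i => hU _)

theorem Phi_iM (hB : B.IsAlt) {k : ℕ} {v : Fin k → V} (h : ∀ i j, B (v i) (v j) = 0) :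
    Phi B hB (ExteriorAlgebra.ιMulti F k v) = ExteriorAlgebra.ιMulti F k v := by
  induction k with
  | zero =>
    rw [ExteriorAlgebra.ιMulti_zero_apply]
    simpa using Phi_algebraMap B hB (1:F)
  | succ k ih =>
    rw [← Fin.cons_self_tail v, iM_cons, Phi_mul, ih (v := Fin.tail v) fun i j => h _ _]
    rw [con_EP_zero (U := LinearMap.ker (B (v 0))) (fun u hu => hu) (iM_mem_EP fun i => ?_),
      sub_zero]
    exact h _ _

theorem SS_le_KK (hB : B.IsAlt) (U : Submodule F V) (k : ℕ) : SS B U k ≤ KK B hB U k :=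
  SS_le fun _ hv h => (mem_KK B hB).2 ⟨iM_mem_EP hv, Phi_iM hB h⟩

theorem SS_le_EP (U : Submodule F V) (k : ℕ) : SS B U k ≤ EP U k :=
  SS_le fun _ hv _ => iM_mem_EP hv

theorem SS_finite [FiniteDimensional F V] (U : Submodule F V) (k : ℕ) :
    FiniteDimensional F (SS B U k) := by
  have := EP_finite (F := F) U k
  exact Submodule.finiteDimensional_of_le (SS_le_EP U k)

theorem SS_mono {U U' : Submodule F V} (h : U ≤ U') (k : ℕ) : SS B U k ≤ SS B U' k :=
  SS_le fun _ hv h' => mem_SS (fun i => h (hv i)) h'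

theorem iso_cons (hB : B.IsAlt) {k : ℕ} {x : V} {v : Fin k → V} (h : ∀ i j, B (v i) (v j) = 0)
    (hx : ∀ i, B x (v i) = 0) (i j : Fin (k+1)) :
    B ((Fin.cons x v : Fin (k+1) → V) i) ((Fin.cons x v : Fin (k+1) → V) j) = 0 := by
  refine Fin.cases ?_ (fun i => ?_) i <;> refine Fin.cases ?_ (fun j => ?_) j
  · exact hB x
  · exact hx j
  · rw [Fin.cons_zero, Fin.cons_succ, alt_swap hB, hx i, neg_zero]
  · exact h i j

theorem SS_mul (hB : B.IsAlt) {U U' : Submodule F V} (hU : U ≤ U') {x : V} (hx : x ∈ U')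
    (hxU : ∀ u ∈ U, B x u = 0) {k : ℕ} {w : ExteriorAlgebra F V} (hw : w ∈ SS B U k) :
    ExteriorAlgebra.ι F x * w ∈ SS B U' (k+1) := by
  have : SS B U k ≤ (SS B U' (k+1)).comap (LinearMap.mulLeft F (ExteriorAlgebra.ι F x)) := by
    refine SS_le fun v hv h => ?_
    change ExteriorAlgebra.ι F x * ExteriorAlgebra.ιMulti F k v ∈ SS B U' (k+1)
    rw [← iM_cons]
    refine mem_SS ?_ (iso_cons hB h fun i => hxU _ (hv i))
    intro i
    exact Fin.cases hx (fun i => hU (hv i)) i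
  exact this hw

theorem low_step [FiniteDimensional F V] {U : Submodule F V} {x : V} {d : Module.Dual F V}
    (hd : ∀ u ∈ U, d u = 0) (hdx : d x = 1) {k : ℕ} (X Y : Submodule F (ExteriorAlgebra F V))
    [FiniteDimensional F X]
    (h1 : ∀ w ∈ SS B U k, ExteriorAlgebra.ι F x * w ∈ X)
    (h2 : Y ≤ X) (h3 : ∀ w ∈ Y, con d w = 0) :
    finrank F (SS B U k) + finrank F Y ≤ finrank F X := by
  rw [finrank_split X (con d)]
  refine add_le_add (Submodule.finrank_mono ?_) (Submodule.finrank_mono ?_)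
  · intro w hw
    refine ⟨_, h1 w hw, ?_⟩
    rw [con_mul, con_EP_zero hd (SS_le_EP U k hw), hdx]
    simp
  · intro w hw
    exact ⟨h2 hw, h3 w hw⟩

theorem low3 [FiniteDimensional F V] (hB : B.IsAlt) {U : Submodule F V} {e f : V}
    (he : ∀ u ∈ U, B e u = 0) (hf : ∀ u ∈ U, B f u = 0) (hef : B e f = 1)
    {k : ℕ} (X : Submodule F (ExteriorAlgebra F V)) [FiniteDimensional F X]
    (h1 : ∀ w ∈ SS B U k, ExteriorAlgebra.ι F e * w ∈ X)
    (h2 : ∀ w ∈ SS B U k, ExteriorAlgebra.ι F f * w ∈ X)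
    (h3 : SS B U (k+1) ≤ X) :
    2 * finrank F (SS B U k) + finrank F (SS B U (k+1)) ≤ finrank F X := by
  have hfe : B f e = -1 := by rw [alt_swap hB, hef]
  have hf' : ∀ u ∈ U, (-B f) u = 0 := fun u hu => by simp [hf u hu]
  have s1 := low_step (B := B) (x := e) (k := k) hf' (by simp [hfe]) X
    (X ⊓ LinearMap.ker (con (-B f))) h1 inf_le_left (fun w hw => hw.2)
  have s2 := low_step (B := B) (x := f) (k := k) he hef (X ⊓ LinearMap.ker (con (-B f)))
    (SS B U (k+1)) ?_ ?_ ?_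
  · omega
  · intro w hw
    refine ⟨h2 w hw, ?_⟩
    change con (-B f) _ = 0
    rw [con_mul, con_EP_zero hf' (SS_le_EP U k hw)]
    simp [hB f]
  · intro w hw
    exact ⟨h3 hw, con_EP_zero hf' (SS_le_EP U _ hw)⟩
  · intro w hw
    exact con_EP_zero he (SS_le_EP U _ hw)

theorem symp_nondeg (hB : B.IsAlt) {m : ℕ} {U : Submodule F V} (hU : Symp B m U) :
    ∀ u ∈ U, (∀ w ∈ U, B u w = 0) → u = 0 := by
  induction hU with
  | bot => intro u hu _; simpa using hu
  | @hyp m U e f hU he hf hef ih =>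
    intro u hu hw
    obtain ⟨z, hz, x, hx, rfl⟩ := Submodule.mem_sup.mp hu
    clear hu
    obtain ⟨b, rfl⟩ := Submodule.mem_span_singleton.mp hx
    obtain ⟨u, hu, y, hy, rfl⟩ := Submodule.mem_sup.mp hz
    obtain ⟨a, rfl⟩ := Submodule.mem_span_singleton.mp hy
    have hfe : B f e = -1 := by rw [alt_swap hB, hef]
    have hU' : U ≤ U ⊔ Submodule.span F {f} ⊔ Submodule.span F {e} :=
      le_sup_left.trans le_sup_left
    have hu1 : B u e = 0 := by rw [alt_swap hB, he u hu, neg_zero]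
    have hu2 : B u f = 0 := by rw [alt_swap hB, hf u hu, neg_zero]
    have h1 := hw e (Submodule.mem_sup_right (Submodule.mem_span_singleton_self e))
    have h2 := hw f (Submodule.mem_sup_left
      (Submodule.mem_sup_right (Submodule.mem_span_singleton_self f)))
    simp [hu1, hfe, hB e] at h1
    simp [hu2, hef, hB f] at h2
    subst h1 h2
    have := ih u hu (fun w hw' => by simpa using hw w (hU' hw'))
    simp [this]

theorem exists_pair [FiniteDimensional F V] (hB : B.IsAlt) {m : ℕ} {U : Submodule F V}
    (hU : Symp B m U) {j : ℕ} (v : Fin j → V) (hj : j < m) :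
    ∃ p ∈ U, ∃ r ∈ U, (∀ i, B p (v i) = 0) ∧ (∀ i, B r (v i) = 0) ∧ B p r = -1 := by
  set T := Submodule.span F (Set.range v)
  set W := U ⊓ B.orthogonal T with hW
  have hT : finrank F T ≤ j := by
    have := finrank_range_le_card (R := F) v
    rw [Fintype.card_fin] at this
    exact this
  have hrefl : B.IsRefl := hB.isRefl
  have hfU : finrank F U = 2 * m := by simpa using finrank_exd hB (Exd.base hU)
  have hUU : U ⊓ B.orthogonal U = ⊥ := by
    rw [eq_bot_iff]
    intro u hu
    refine (Submodule.mem_bot F).2 (symp_nondeg hB hU u hu.1 fun w hw => ?_)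
    have := LinearMap.BilinForm.mem_orthogonal_iff.1 hu.2 w hw
    exact hrefl _ _ this
  have hrad : ∀ W' ≤ U, W' ⊓ B.orthogonal ⊤ = ⊥ := by
    intro W' h
    rw [eq_bot_iff, ← hUU]
    exact inf_le_inf h (LinearMap.BilinForm.orthogonal_le le_top)
  by_cases hiso : ∀ p ∈ W, ∀ r ∈ W, B p r = 0
  · exfalso
    have e1 := B.finrank_add_finrank_orthogonal hrefl W
    have e2 := B.finrank_add_finrank_orthogonal hrefl U
    have e3 := B.finrank_add_finrank_orthogonal hrefl T
    rw [hrad W inf_le_left, finrank_bot] at e1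
    rw [hrad U le_rfl, finrank_bot] at e2
    have e4 := Submodule.finrank_sup_add_finrank_inf_eq W (B.orthogonal U)
    have : W ⊓ B.orthogonal U = ⊥ := by
      rw [eq_bot_iff, ← hUU]; exact inf_le_inf inf_le_left le_rfl
    rw [this, finrank_bot] at e4
    have e5 : finrank F (W ⊔ B.orthogonal U : Submodule F V) ≤ finrank F (B.orthogonal W) := by
      refine Submodule.finrank_mono (sup_le ?_ (LinearMap.BilinForm.orthogonal_le inf_le_left))
      intro x hx
      exact LinearMap.BilinForm.mem_orthogonal_iff.2 fun y hy => hiso y hy x hx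
    have e6 := Submodule.finrank_sup_add_finrank_inf_eq U (B.orthogonal T)
    rw [← hW] at e6
    have e7 := Submodule.finrank_le (U ⊔ B.orthogonal T)
    omega
  · push Not at hiso
    obtain ⟨p, hp, r, hr, hpr⟩ := hiso
    have hort : ∀ p ∈ W, ∀ i, B p (v i) = 0 := fun p hp i =>
      hrefl _ _ (LinearMap.BilinForm.mem_orthogonal_iff.1 hp.2 (v i)
        (Submodule.subset_span ⟨i, rfl⟩))
    refine ⟨(-(B p r)⁻¹) • p, U.smul_mem _ hp.1, r, hr.1, fun i => ?_, hort r hr, ?_⟩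
    · simp [hort p hp i]
    · simp [hpr]

theorem low_symp_pair [FiniteDimensional F V] (hB : B.IsAlt) {m : ℕ} {U : Submodule F V} {e f : V}
    (hU : Symp B m U)
    (he : ∀ u ∈ U, B e u = 0) (hf : ∀ u ∈ U, B f u = 0) (hef : B e f = 1) {j : ℕ} (hj : j < m) :
    SS B U j ≤ (SS B (U ⊔ Submodule.span F {f} ⊔ Submodule.span F {e}) (j+1+1)).map
      (con (B e) ∘ₗ con (-B f)) := by
  refine SS_le fun v hv h => ?_
  obtain ⟨p, hp, r, hr, hpv, hrv, hpr⟩ := exists_pair hB hU v hj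
  have hfe : B f e = -1 := by rw [alt_swap hB, hef]
  have hf' : ∀ u ∈ U, (-B f) u = 0 := fun u hu => by simp [hf u hu]
  have hU' : U ≤ U ⊔ Submodule.span F {f} ⊔ Submodule.span F {e} :=
    le_sup_left.trans le_sup_left
  have heU : e ∈ U ⊔ Submodule.span F {f} ⊔ Submodule.span F {e} :=
    Submodule.mem_sup_right (Submodule.mem_span_singleton_self e)
  have hfU : f ∈ U ⊔ Submodule.span F {f} ⊔ Submodule.span F {e} :=
    Submodule.mem_sup_left (Submodule.mem_sup_right (Submodule.mem_span_singleton_self f))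
  have hpf : B p f = 0 := by rw [alt_swap hB, hf p hp, neg_zero]
  refine ⟨ExteriorAlgebra.ιMulti F (j+2) (Fin.cons (p+e) (Fin.cons (r+f) v : Fin (j+1) → V) :
    Fin (j+2) → V), ?_, ?_⟩
  · refine mem_SS ?_ (iso_cons hB (iso_cons hB h ?_) ?_)
    · intro i
      refine Fin.cases (add_mem (hU' hp) heU) (fun i => ?_) i
      exact Fin.cases (add_mem (hU' hr) hfU) (fun i => hU' (hv i)) i
    · intro i
      simp [hrv i, hf _ (hv i)]
    · intro i
      refine Fin.cases ?_ (fun i => ?_) i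
      · simp [hpr, hpf, he r hr, hef]
      · simp [hpv i, he _ (hv i)]
  · rw [iM_cons, iM_cons, LinearMap.comp_apply]
    have hw := iM_mem_EP (F := F) hv
    generalize ExteriorAlgebra.ιMulti F j v = w at hw
    rw [con_mul, con_mul, con_EP_zero hf' hw, map_add (-B f), map_add (-B f), hf' p hp, hf' r hr]
    have e1 : (-B f) e = 1 := by simp [hfe]
    have e2 : (-B f) f = 0 := by simp [hB f]
    rw [e1, e2, zero_add, zero_add, zero_smul, mul_zero, sub_zero, mul_zero, sub_zero, one_smul]
    rw [con_mul, con_EP_zero he hw, map_add, he r hr, hef]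
    simp

theorem SS_zero [FiniteDimensional F V] (U : Submodule F V) : 1 ≤ finrank F (SS B U 0) := by
  have h : (1 : ExteriorAlgebra F V) ∈ SS B U 0 := by
    have := mem_SS (B := B) (U := U) (v := (Fin.elim0 : Fin 0 → V)) (fun i => i.elim0) (fun i => i.elim0)
    rwa [ExteriorAlgebra.ιMulti_zero_apply] at this
  have := SS_finite (B := B) U 0
  refine Nat.one_le_iff_ne_zero.2 fun h0 => ?_
  rw [Submodule.finrank_eq_zero] at h0
  rw [h0, Submodule.mem_bot] at h
  exact one_ne_zero h

theorem choose_dec (m j : ℕ) (h : m ≤ j) : (2*m+2).choose (j+2) ≤ (2*m+2).choose j := by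
  have h1 := Nat.choose_succ_right_eq (2*m+2) j
  have h2 := Nat.choose_succ_right_eq (2*m+2) (j+1)
  have h3 : (2*m+2).choose (j+2) * ((j+2) * (j+1)) =
      (2*m+2).choose j * ((2*m+2-j) * (2*m+2-(j+1))) := by
    calc _ = ((2*m+2).choose (j+1+1) * (j+1+1)) * (j+1) := by ring
      _ = ((2*m+2).choose (j+1) * (j+1)) * (2*m+2-(j+1)) := by rw [h2]; ring
      _ = _ := by rw [h1]; ring
  have h4 : (2*m+2-j) * (2*m+2-(j+1)) ≤ (j+2) * (j+1) := Nat.mul_le_mul (by omega) (by omega)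
  have h5 : (2*m+2).choose (j+2) * ((j+2) * (j+1)) ≤ (2*m+2).choose j * ((j+2) * (j+1)) := by
    rw [h3]; exact Nat.mul_le_mul_left _ h4
  exact Nat.le_of_mul_le_mul_right h5 (by positivity)

theorem lower_symp [FiniteDimensional F V] (hB : B.IsAlt) {m : ℕ} {U : Submodule F V}
    (hU : Symp B m U) : ∀ k, (2*m).choose k ≤ finrank F (SS B U k) + c2 (2*m) k := by
  induction hU with
  | bot =>
    intro k
    rcases k with _ | k
    · have := SS_zero (B := B) (⊥ : Submodule F V)
      simp; omega
    · simp
  | @hyp m U e f hU he hf hef ih =>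
    intro k
    have hU' : U ≤ U ⊔ Submodule.span F {f} ⊔ Submodule.span F {e} :=
      le_sup_left.trans le_sup_left
    have heU : e ∈ U ⊔ Submodule.span F {f} ⊔ Submodule.span F {e} :=
      Submodule.mem_sup_right (Submodule.mem_span_singleton_self e)
    have hfU : f ∈ U ⊔ Submodule.span F {f} ⊔ Submodule.span F {e} :=
      Submodule.mem_sup_left (Submodule.mem_sup_right (Submodule.mem_span_singleton_self f))
    set U' := U ⊔ Submodule.span F {f} ⊔ Submodule.span F {e} with hU'd
    have fin := fun k => SS_finite (B := B) U' k
    rcases k with _ | _ | j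
    · have := SS_zero (B := B) U'
      simp; omega
    · have h := low3 hB he hf hef (k := 0) (SS B U' 1) (fun w hw => SS_mul hB hU' heU he hw)
        (fun w hw => SS_mul hB hU' hfU hf hw) (SS_mono hU' 1)
      have h0 := SS_zero (B := B) U
      have h1 := ih 1
      simp [c2] at h1 h ⊢
      omega
    · rcases Nat.lt_or_ge j m with hj | hj
      · have hs := finrank_split (SS B U' (j+1+1)) (con (B e) ∘ₗ con (-B f))
        have hl := Submodule.finrank_mono (low_symp_pair hB hU he hf hef hj)
        rw [← hU'd] at hl
        have hfe : B f e = -1 := by rw [alt_swap hB, hef]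
        have hf' : ∀ u ∈ U, (-B f) u = 0 := fun u hu => by simp [hf u hu]
        have h := low3 hB he hf hef (k := j+1)
          (SS B U' (j+1+1) ⊓ LinearMap.ker (con (B e) ∘ₗ con (-B f)))
          (fun w hw => ⟨SS_mul hB hU' heU he hw, ?_⟩)
          (fun w hw => ⟨SS_mul hB hU' hfU hf hw, ?_⟩)
          (fun w hw => ⟨SS_mono hU' _ hw, ?_⟩)
        · have i0 := ih j
          have i1 := ih (j+1)
          have i2 := ih (j+1+1)
          have q1 := Nat.choose_succ_succ' (2*m+1) (j+1)
          have q2 := Nat.choose_succ_succ' (2*m) j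
          have q3 := Nat.choose_succ_succ' (2*m) (j+1)
          have r1 := c2_succ (2*m+1) (j+1)
          have r2 := c2_succ (2*m) j
          have r3 := c2_succ (2*m) (j+1)
          rw [show 2*(m+1) = 2*m+1+1 by ring]
          omega
        · change con (B e) (con (-B f) _) = 0
          rw [con_mul, con_EP_zero hf' (SS_le_EP U _ hw), mul_zero, sub_zero, map_smul,
            con_EP_zero he (SS_le_EP U _ hw), smul_zero]
        · change con (B e) (con (-B f) _) = 0
          rw [con_mul, con_EP_zero hf' (SS_le_EP U _ hw), mul_zero, sub_zero, map_smul,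
            con_EP_zero he (SS_le_EP U _ hw), smul_zero]
        · change con (B e) (con (-B f) _) = 0
          rw [con_EP_zero hf' (SS_le_EP U _ hw), map_zero]
      · have := choose_dec m j hj
        unfold c2
        rw [if_pos (by omega)]
        exact this.trans (Nat.le_add_left _ _)

theorem lower_exd [FiniteDimensional F V] (hB : B.IsAlt) {m r : ℕ} {U : Submodule F V}
    (hU : Exd B m r U) :
    ∀ k, (2*m+r).choose k ≤ finrank F (SS B U k) + c2 (2*m+r) k := by
  induction hU with
  | base h => exact lower_symp hB h
  | @rad r U x _ hx hxU ih =>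
    obtain ⟨d, h1, h2⟩ := exists_dual hx
    intro k
    rcases k with _ | k
    · have := SS_zero (B := B) (U ⊔ Submodule.span F {x})
      simp; omega
    · have := SS_finite (B := B) (U ⊔ Submodule.span F {x}) (k+1)
      have h := low_step (B := B) (k := k) h1 h2 (SS B (U ⊔ Submodule.span F {x}) (k+1))
        (SS B U (k+1))
        (fun w hw => SS_mul hB le_sup_left
          (Submodule.mem_sup_right (Submodule.mem_span_singleton_self x)) hxU hw)
        (SS_mono le_sup_left _)
        (fun w hw => con_EP_zero h1 (SS_le_EP U _ hw))
      have i1 := ih k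
      have i2 := ih (k+1)
      rw [← add_assoc, c2_succ, Nat.choose_succ_succ']
      omega

end Lower
end PolarGrass
namespace PolarGrass

section Exist

open Module

variable {F : Type*} [Field F] {V : Type*} [AddCommGroup V] [Module F V]
variable {B : LinearMap.BilinForm F V}

theorem exd_swap (hB : B.IsAlt) {m r : ℕ} {U : Submodule F V} (hU : Exd B m r U) {e f : V}
    (he : ∀ u ∈ U, B e u = 0) (hf : ∀ u ∈ U, B f u = 0) (hef : B e f = 1) :
    Exd B (m+1) r (U ⊔ Submodule.span F {f} ⊔ Submodule.span F {e}) := by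
  induction hU with
  | base h => exact Exd.base (Symp.hyp h he hf hef)
  | @rad r U x hU hx hxU ih =>
    have hfe : B f e = -1 := by rw [alt_swap hB, hef]
    have hxm : x ∈ U ⊔ Submodule.span F {x} :=
      Submodule.mem_sup_right (Submodule.mem_span_singleton_self x)
    have he' : ∀ u ∈ U, B e u = 0 := fun u hu => he u (Submodule.mem_sup_left hu)
    have hf' : ∀ u ∈ U, B f u = 0 := fun u hu => hf u (Submodule.mem_sup_left hu)
    have h1 := ih he' hf'
    have h2 := Exd.rad (x := x) h1 ?_ ?_
    · have : U ⊔ Submodule.span F {x} ⊔ Submodule.span F {f} ⊔ Submodule.span F {e} =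
        U ⊔ Submodule.span F {f} ⊔ Submodule.span F {e} ⊔ Submodule.span F {x} := by ac_rfl
      rw [this]
      exact h2
    · intro hx'
      obtain ⟨z, hz, x', hx'', hh⟩ := Submodule.mem_sup.mp hx'
      obtain ⟨b, rfl⟩ := Submodule.mem_span_singleton.mp hx''
      obtain ⟨u, hu, y, hy, rfl⟩ := Submodule.mem_sup.mp hz
      obtain ⟨a, rfl⟩ := Submodule.mem_span_singleton.mp hy
      have a0 := he x hxm
      have b0 := hf x hxm
      rw [← hh] at a0 b0
      simp [he' u hu, hef, hB e] at a0
      simp [hf' u hu, hfe, hB f] at b0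
      subst a0 b0
      apply hx
      rw [← hh]
      simpa using hu
    · intro u hu
      obtain ⟨z, hz, x', hx'', rfl⟩ := Submodule.mem_sup.mp hu
      clear hu
      obtain ⟨b, rfl⟩ := Submodule.mem_span_singleton.mp hx''
      obtain ⟨u, hu, y, hy, rfl⟩ := Submodule.mem_sup.mp hz
      obtain ⟨a, rfl⟩ := Submodule.mem_span_singleton.mp hy
      have a0 : B x e = 0 := by rw [alt_swap hB, he x hxm, neg_zero]
      have b0 : B x f = 0 := by rw [alt_swap hB, hf x hxm, neg_zero]
      simp [hxU u hu, a0, b0]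

theorem exists_exd [FiniteDimensional F V] (hB : B.IsAlt) :
    ∀ (N : ℕ) (U : Submodule F V), finrank F U = N → ∃ m r, Exd B m r U := by
  intro N
  induction N using Nat.strong_induction_on with
  | _ N ih =>
  intro U hN
  have ih' : ∀ U' < U, ∃ m r, Exd B m r U' := fun U' h =>
    ih _ (hN ▸ Submodule.finrank_lt_finrank_of_lt h) U' rfl
  by_cases hiso : ∀ x ∈ U, ∀ y ∈ U, B x y = 0
  · by_cases hbot : U = ⊥
    · subst hbot
      exact ⟨0, 0, Exd.base Symp.bot⟩
    · obtain ⟨x, hx, hx0⟩ := Submodule.exists_mem_ne_zero_of_ne_bot hbot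
      obtain ⟨d, -, hd⟩ := exists_dual (F := F) (U := (⊥ : Submodule F V)) (x := x) (by simpa using hx0)
      have hxn : x ∉ U ⊓ LinearMap.ker d := by
        rintro ⟨-, h⟩
        have h : d x = 0 := h
        rw [hd] at h
        exact one_ne_zero h
      have hlt : U ⊓ LinearMap.ker d < U :=
        lt_of_le_of_ne inf_le_left fun h => hxn (h.symm.le hx)
      obtain ⟨m, r, h⟩ := ih' _ hlt
      refine ⟨m, r+1, ?_⟩
      have h2 := Exd.rad h hxn (fun u hu => hiso x hx u hu.1)
      have : U ⊓ LinearMap.ker d ⊔ Submodule.span F {x} = U := by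
        apply le_antisymm
        · exact sup_le inf_le_left (by simpa [Submodule.span_singleton_le_iff_mem] using hx)
        · intro u hu
          refine Submodule.mem_sup.2 ⟨u - d u • x, ⟨sub_mem hu (U.smul_mem _ hx), ?_⟩, d u • x,
            Submodule.mem_span_singleton.2 ⟨_, rfl⟩, by abel⟩
          change d _ = 0
          simp [hd]
      rwa [this] at h2
  · push Not at hiso
    obtain ⟨e', he', f, hf, hef'⟩ := hiso
    obtain ⟨e, he, hef⟩ : ∃ e ∈ U, B e f = 1 :=
      ⟨(B e' f)⁻¹ • e', U.smul_mem _ he', by simp [hef']⟩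
    have hfe : B f e = -1 := by rw [alt_swap hB, hef]
    set U' := U ⊓ LinearMap.ker (B e) ⊓ LinearMap.ker (B f) with hU'
    have hlt : U' < U := by
      refine lt_of_le_of_ne (inf_le_left.trans inf_le_left) fun h => ?_
      have : e ∈ U' := h.symm.le he
      have : B f e = 0 := this.2
      rw [hfe] at this
      simp at this
    obtain ⟨m, r, h⟩ := ih' _ hlt
    refine ⟨m+1, r, ?_⟩
    have h2 := exd_swap hB h (e := e) (f := f) (fun u hu => hu.1.2) (fun u hu => hu.2) hef
    have : U' ⊔ Submodule.span F {f} ⊔ Submodule.span F {e} = U := by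
      apply le_antisymm
      · exact sup_le (sup_le hlt.le (by simpa [Submodule.span_singleton_le_iff_mem] using hf))
          (by simpa [Submodule.span_singleton_le_iff_mem] using he)
      · intro u hu
        refine Submodule.mem_sup.2 ⟨(u - B e u • f + B f u • e) + B e u • f,
          Submodule.mem_sup.2 ⟨_, ⟨⟨?_, ?_⟩, ?_⟩, _, Submodule.mem_span_singleton.2 ⟨_, rfl⟩, rfl⟩,
          (-B f u) • e, Submodule.mem_span_singleton.2 ⟨_, rfl⟩, ?_⟩
        · exact add_mem (sub_mem hu (U.smul_mem _ hf)) (U.smul_mem _ he)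
        · change B e _ = 0
          simp [hef, hB e]
        · change B f _ = 0
          simp [hfe, hB f]
        · rw [neg_smul]; abel
    rwa [this] at h2

theorem exd_rad [FiniteDimensional F V] (hB : B.IsAlt) {m r : ℕ} {U : Submodule F V}
    (hU : Exd B m r U) : r ≤ finrank F (U ⊓ B.orthogonal U : Submodule F V) := by
  induction hU with
  | base h => exact Nat.zero_le _
  | @rad r U x hU hx hxU ih =>
    have hxn : x ∉ U ⊓ B.orthogonal U := fun h => hx h.1
    have h1 := Submodule.finrank_sup_span_singleton hxn
    refine (Nat.succ_le_succ ih).trans (h1.symm.le.trans (Submodule.finrank_mono ?_))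
    refine sup_le ?_ ?_
    · rintro u ⟨hu, hu'⟩
      refine ⟨Submodule.mem_sup_left hu, LinearMap.BilinForm.mem_orthogonal_iff.2 ?_⟩
      intro w hw
      obtain ⟨w', hw', y, hy, rfl⟩ := Submodule.mem_sup.mp hw
      obtain ⟨a, rfl⟩ := Submodule.mem_span_singleton.mp hy
      have : B w' u = 0 := LinearMap.BilinForm.mem_orthogonal_iff.1 hu' w' hw'
      change B _ u = 0
      simp [this, hxU u hu]
    · rw [Submodule.span_singleton_le_iff_mem]
      refine ⟨Submodule.mem_sup_right (Submodule.mem_span_singleton_self x),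
        LinearMap.BilinForm.mem_orthogonal_iff.2 ?_⟩
      intro w hw
      obtain ⟨w', hw', y, hy, rfl⟩ := Submodule.mem_sup.mp hw
      obtain ⟨a, rfl⟩ := Submodule.mem_span_singleton.mp hy
      have : B w' x = 0 := by rw [alt_swap hB, hxU w' hw', neg_zero]
      change B _ x = 0
      simp [this, hB x]

variable {n : ℕ} {e f : Fin n → V}

theorem dual_sum (hef : ∀ i j, B (e i) (f j) = if i = j then 1 else 0) (c : Fin n → F) (j : Fin n) :
    B (∑ i, c i • e i) (f j) = c j := by
  simp [hef]

theorem finrank_M (hef : ∀ i j, B (e i) (f j) = if i = j then 1 else 0) :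
    finrank F (Submodule.span F (Set.range e)) = n := by
  have : LinearIndependent F e := by
    rw [Fintype.linearIndependent_iff]
    intro g hg i
    rw [← dual_sum hef g i, hg]
    simp
  rw [finrank_span_eq_card this, Fintype.card_fin]

theorem M_rad (hef : ∀ i j, B (e i) (f j) = if i = j then 1 else 0) (hB : B.IsAlt)
    {A : Submodule F V} (hA : A ≤ Submodule.span F (Set.range e)) : A ⊓ B.orthogonal ⊤ = ⊥ := by
  rw [eq_bot_iff]
  rintro x ⟨hx, hx'⟩
  obtain ⟨c, rfl⟩ := (Submodule.mem_span_range_iff_exists_fun F).1 (hA hx)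
  have : ∀ j, c j = 0 := by
    intro j
    rw [← dual_sum hef c j]
    exact hB.isRefl _ _ (LinearMap.BilinForm.mem_orthogonal_iff.1 hx' (f j) trivial)
  simp [this]

theorem n_le_m [FiniteDimensional F V] (hB : B.IsAlt)
    (hee : ∀ i j, B (e i) (e j) = 0) (hef : ∀ i j, B (e i) (f j) = if i = j then 1 else 0)
    {m r : ℕ} (h : Exd B m r ⊤) : n ≤ m := by
  have h1 := finrank_exd hB h
  have h2 := exd_rad hB h
  rw [top_inf_eq] at h2
  rw [finrank_top] at h1
  have h3 := B.finrank_add_finrank_orthogonal hB.isRefl (Submodule.span F (Set.range e))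
  have h4 := Submodule.finrank_sup_add_finrank_inf_eq (Submodule.span F (Set.range e))
    (B.orthogonal ⊤)
  rw [M_rad hef hB le_rfl, finrank_bot, finrank_M hef] at h3 h4
  have h5 : finrank F (Submodule.span F (Set.range e) ⊔ B.orthogonal ⊤ : Submodule F V) ≤
      finrank F (B.orthogonal (Submodule.span F (Set.range e))) := by
    refine Submodule.finrank_mono (sup_le ?_ (LinearMap.BilinForm.orthogonal_le le_top))
    intro x hx
    exact LinearMap.BilinForm.mem_orthogonal_iff.2 fun y hy => totSing_span hee y hy x hx
  omega

theorem lemX [FiniteDimensional F V] (hB : B.IsAlt)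
    (hee : ∀ i j, B (e i) (e j) = 0) (hef : ∀ i j, B (e i) (f j) = if i = j then 1 else 0)
    (T : Submodule F V) (hT : finrank F T < n) :
    ∃ g ∈ Submodule.span F (Set.range e), g ∈ B.orthogonal T ∧ ∃ h ∈ B.orthogonal T, B g h ≠ 0 := by
  by_contra hcon
  push Not at hcon
  set M := Submodule.span F (Set.range e)
  have e1 := B.finrank_add_finrank_orthogonal hB.isRefl (B.orthogonal T ⊓ M)
  rw [M_rad hef hB inf_le_right, finrank_bot] at e1
  have e2 := B.finrank_add_finrank_orthogonal hB.isRefl T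
  have e3 := Submodule.finrank_sup_add_finrank_inf_eq (B.orthogonal T) M
  have e4 : finrank F M = n := finrank_M hef
  have e5 : finrank F (B.orthogonal T ⊔ M : Submodule F V) ≤
      finrank F (B.orthogonal (B.orthogonal T ⊓ M)) := by
    refine Submodule.finrank_mono (sup_le ?_ ?_)
    · intro h hh
      exact LinearMap.BilinForm.mem_orthogonal_iff.2 fun g hg => hcon g hg.2 hg.1 h hh
    · intro x hx
      exact LinearMap.BilinForm.mem_orthogonal_iff.2 fun y hy => totSing_span hee y hy.2 x hx
  omega

variable {q : QuadraticForm F V}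

theorem totSingQ_span {k : ℕ} {v : Fin k → V}
    (h : ∀ i j, q.polarBilin (v i) (v j) = 0) (hq : ∀ i, q (v i) = 0) :
    TotSingQ F V q (Submodule.span F (Set.range v)) := by
  intro x hx
  induction hx using Submodule.span_induction with
  | mem x hx => obtain ⟨i, rfl⟩ := hx; exact hq i
  | zero => simp
  | add x y hx hy h1 h2 =>
    have : q.polarBilin x y = 0 := totSing_span h x hx y hy
    rw [QuadraticMap.polarBilin_apply_apply] at this
    rw [QuadraticMap.map_add (⇑q), h1, h2, this]; simp
  | smul a x _ h1 => rw [QuadraticMap.map_smul, h1, smul_zero]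

theorem sing_span [FiniteDimensional F V] (hB : q.polarBilin.IsAlt)
    (hee : ∀ i j, q.polarBilin (e i) (e j) = 0) (hqe : ∀ i, q (e i) = 0)
    (hef : ∀ i j, q.polarBilin (e i) (f j) = if i = j then 1 else 0)
    (T : Submodule F V) (hT : finrank F T < n) :
    LinearMap.BilinForm.orthogonal q.polarBilin T ≤
      Submodule.span F {w | w ∈ LinearMap.BilinForm.orthogonal q.polarBilin T ∧ q w = 0} := by
  obtain ⟨g, hg, hgT, h, hhT, hgh⟩ := lemX hB hee hef T hT
  have hqg : q g = 0 := totSingQ_span hee hqe g hg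
  set W := LinearMap.BilinForm.orthogonal q.polarBilin T
  have key : ∀ w ∈ W, q.polarBilin g w ≠ 0 → w ∈ Submodule.span F {w | w ∈ W ∧ q w = 0} := by
    intro w hw hgw
    have hwg : q.polarBilin w g ≠ 0 := by
      rw [alt_swap hB]; simpa using hgw
    set t := -(q w) / q.polarBilin w g with ht
    have : w = (w + t • g) - t • g := by abel
    rw [this]
    refine sub_mem (Submodule.subset_span ⟨add_mem hw (W.smul_mem _ hgT), ?_⟩)
      (Submodule.smul_mem _ _ (Submodule.subset_span ⟨hgT, hqg⟩))
    have hp : QuadraticMap.polar q w (t • g) = t * q.polarBilin w g := by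
      rw [← QuadraticMap.polarBilin_apply_apply, map_smul, smul_eq_mul]
    rw [QuadraticMap.map_add (⇑q), QuadraticMap.map_smul, hqg, hp, ht, div_mul_cancel₀ _ hwg]
    simp
  intro w hw
  by_cases hgw : q.polarBilin g w = 0
  · have h1 := key (w + h) (add_mem hw hhT) (by rw [map_add, hgw, zero_add]; exact hgh)
    have h2 := sub_mem h1 (key h hhT hgh)
    simpa using h2
  · exact key w hw hgw

theorem SS_le_G [FiniteDimensional F V] (hB : q.polarBilin.IsAlt)
    (hee : ∀ i j, q.polarBilin (e i) (e j) = 0) (hqe : ∀ i, q (e i) = 0)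
    (hef : ∀ i j, q.polarBilin (e i) (f j) = if i = j then 1 else 0)
    {k : ℕ} (hk : k ≤ n) : SS q.polarBilin ⊤ k ≤ grassmann F V (TotSingQ F V q) k := by
  have claim : ∀ (j : ℕ) (v : Fin k → V), (∀ i i', q.polarBilin (v i) (v i') = 0) →
      (∀ i : Fin k, j ≤ i.val → q (v i) = 0) →
      ExteriorAlgebra.ιMulti F k v ∈ grassmann F V (TotSingQ F V q) k := by
    intro j
    induction j with
    | zero =>
      intro v hv hq
      by_cases hli : LinearIndependent F v
      · exact Submodule.subset_span ⟨v, fun _ => trivial, hli,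
          totSingQ_span hv (fun i => hq i (Nat.zero_le _)), rfl⟩
      · rw [AlternatingMap.map_linearDependent _ v hli]
        exact zero_mem _
    | succ j ih =>
      intro v hv hq
      rcases Nat.lt_or_ge j k with hjk | hjk
      swap
      · exact ih v hv fun i hi => absurd i.2 (by omega)
      set J : Fin k := ⟨j, hjk⟩ with hJ
      set T := Submodule.span F (Set.range fun i : {i : Fin k // i ≠ J} => v i) with hTd
      have hT : finrank F T < n := by
        have := finrank_range_le_card (R := F) (fun i : {i : Fin k // i ≠ J} => v i)
        have h2 : Fintype.card {i : Fin k // i ≠ J} = k - 1 := by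
          simp [Fintype.card_subtype_compl]
        rw [h2] at this
        have h3 : finrank F T ≤ k - 1 := this
        omega
      have hspan := sing_span hB hee hqe hef T hT
      let L := (ExteriorAlgebra.ιMulti F k (M := V)).toMultilinearMap.toLinearMap v J
      have hL : ∀ w, L w = ExteriorAlgebra.ιMulti F k (Function.update v J w) := fun w => rfl
      have hle : Submodule.span F
          {w | w ∈ LinearMap.BilinForm.orthogonal q.polarBilin T ∧ q w = 0} ≤
          (grassmann F V (TotSingQ F V q) k).comap L := by
        refine Submodule.span_le.2 ?_
        rintro w ⟨hw, hqw⟩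
        change L w ∈ grassmann F V (TotSingQ F V q) k
        rw [hL]
        have hwi : ∀ i, i ≠ J → q.polarBilin (v i) w = 0 := fun i hi =>
          LinearMap.BilinForm.mem_orthogonal_iff.1 hw (v i) (Submodule.subset_span ⟨⟨i, hi⟩, rfl⟩)
        refine ih _ ?_ ?_
        · intro i i'
          by_cases h1 : i = J <;> by_cases h2 : i' = J
          · rw [h1, h2]; exact hB _
          · rw [h1, Function.update_self, Function.update_of_ne h2, alt_swap hB, hwi _ h2, neg_zero]
          · rw [h2, Function.update_self, Function.update_of_ne h1, hwi _ h1]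
          · rw [Function.update_of_ne h1, Function.update_of_ne h2, hv]
        · intro i hi
          by_cases h1 : i = J
          · rw [h1, Function.update_self, hqw]
          · rw [Function.update_of_ne h1]
            refine hq i ?_
            have : i.val ≠ j := fun h => h1 (Fin.ext h)
            omega
      have hvJ : v J ∈ LinearMap.BilinForm.orthogonal q.polarBilin T := by
        refine LinearMap.BilinForm.mem_orthogonal_iff.2 fun y hy => ?_
        exact totSing_span hv y (Submodule.span_mono (by rintro _ ⟨i, rfl⟩; exact ⟨i, rfl⟩) hy)
          _ (Submodule.subset_span ⟨J, rfl⟩)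
      have := hle (hspan hvJ)
      have h2 : L (v J) ∈ grassmann F V (TotSingQ F V q) k := this
      rwa [hL, Function.update_eq_self] at h2
  exact SS_le fun v _ hv => claim k v hv fun i hi => absurd i.2 (by omega)

theorem G_le_SS (k : ℕ) : grassmann F V (TotSingQ F V q) k ≤ SS q.polarBilin ⊤ k := by
  refine Submodule.span_mono ?_
  rintro x ⟨v, h1, h2, h3, rfl⟩
  refine ⟨v, h1, h2, ?_, rfl⟩
  intro x hx y hy
  change q (x + y) - q x - q y = 0
  rw [h3 _ (add_mem hx hy), h3 _ hx, h3 _ hy]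
  simp

end Exist
end PolarGrass

open PolarGrass Module in
/-- `char F = 2`, a non-degenerate quadratic form with Witt index `n ≥ 2`
and arbitrary anisotropic defect `d₀ = N - 2n`. For `1 ≤ k ≤ n` the Grassmann image
coincides with the symplectic Grassmann image of `f_q` and has dimension
`N.choose k - N.choose (k-2)` (with `N.choose (-1) = 0`). -/
theorem stmt18 (F : Type*) [Field F] (V : Type*) [AddCommGroup V] [Module F V]
    [FiniteDimensional F V]
    (hchar : ringChar F = 2)
    (q : QuadraticForm F V)
    (hndeg : ∀ v : V, q v = 0 → (∀ w : V, polarF F V q v w = 0) → v = 0)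
    (n d₀ N : ℕ) (hn : 2 ≤ n)
    (hdec : HasWittDecomp F V (polarF F V q) (fun v => q v = 0) (radSetQ F V q) n d₀ 0)
    (hNV : Module.finrank F V = N) (hN : N = 2 * n + d₀) :
    ∀ k : ℕ, 1 ≤ k → k ≤ n →
      grassmann F V (TotSingQ F V q) k = grassmann F V (TotSingB F V (polarF F V q)) k ∧
      Module.finrank F ↥(grassmann F V (TotSingQ F V q) k)
        = N.choose k - (if 2 ≤ k then N.choose (k - 2) else 0) := by
  have h2 : (2 : F) = 0 := by
    have := ringChar.Nat.cast_ringChar (R := F)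
    rw [hchar] at this
    exact_mod_cast this
  have hB : q.polarBilin.IsAlt := by
    intro x
    rw [QuadraticMap.polarBilin_apply_apply, QuadraticMap.polar_self, nsmul_eq_mul]
    simp [h2]
  obtain ⟨W, W₀, R, -, hort, hpl, -⟩ := hdec
  choose e f hW he hf hef using hpl
  have heW : ∀ i, e i ∈ W i := fun i => by
    rw [hW i]; exact Submodule.subset_span (by simp)
  have hfW : ∀ i, f i ∈ W i := fun i => by
    rw [hW i]; exact Submodule.subset_span (by simp)
  have hort' : ∀ i j, i ≠ j → ∀ x ∈ W i, ∀ y ∈ W j, q.polarBilin x y = 0 := by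
    intro i j hij x hx y hy
    exact hort (Sum.inl i) (Sum.inl j) (by simpa using hij) x hx y hy
  have hee : ∀ i j, q.polarBilin (e i) (e j) = 0 := by
    intro i j
    by_cases h : i = j
    · rw [h]; exact hB _
    · exact hort' i j h _ (heW i) _ (heW j)
  have hef' : ∀ i j, q.polarBilin (e i) (f j) = if i = j then 1 else 0 := by
    intro i j
    by_cases h : i = j
    · rw [h, if_pos rfl]; exact hef j
    · rw [if_neg h]; exact hort' i j h _ (heW i) _ (hfW j)
  intro k _ hkn
  have hGS : grassmann F V (TotSingQ F V q) k = SS q.polarBilin ⊤ k :=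
    le_antisymm (G_le_SS k) (SS_le_G hB hee he hef' hkn)
  refine ⟨hGS, ?_⟩
  obtain ⟨m, r, hE⟩ := exists_exd hB _ (⊤ : Submodule F V) rfl
  have hnm := n_le_m hB hee hef' hE
  have hfr := finrank_exd hB hE
  rw [finrank_top, hNV] at hfr
  have hup := upper_exd hB hE k (by omega)
  have hlo := lower_exd hB hE k
  have hfin : FiniteDimensional F (KK q.polarBilin hB ⊤ k) := by
    have := EP_finite (F := F) (⊤ : Submodule F V) k
    exact Submodule.finiteDimensional_of_le (inf_le_left : KK q.polarBilin hB ⊤ k ≤ EP ⊤ k)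
  have hmono := Submodule.finrank_mono (SS_le_KK hB (⊤ : Submodule F V) k)
  rw [hGS, hfr]
  change _ = _ - c2 (2*m+r) k
  omega
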